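/- arXiv:2212.10856 — 7 statements merged into one kernel-verified Lean document; each statement's English description precedes it below -/
import Mathlib

section
/- Let κ ≥ 0 and λ > 0, and define f : ℝ² → ℝ by f(θ₁, θ₂) = exp(κ cos θ₁ + κ cos θ₂ + λ sin θ₁ sin θ₂) (the unnormalized zero-centered bivariate sine von Mises density with κ₁ = κ₂ = κ). Then for every θ ∈ ℝ, at the diagonal point (θ, θ): (i) ∂f/∂θ₁(θ, θ) = ∂f/∂θ₂(θ, θ); (ii) ∂²f/∂θ₁²(θ, θ) = ∂²f/∂θ₂²(θ, θ); (iii) ∂²f/∂θ₁∂θ₂(θ, θ) = (λ cos²θ + (λ sin θ cos θ − κ sin θ)²)·f(θ, θ) ≥ 0; and (iv) Hf(θ, θ)·∇f(θ, θ) = λ₁(θ, θ)·∇f(θ, θ), i.e., the gradient at (θ, θ) lies in the eigenspace of the largest Hessian eigenvalue. -/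
open Real Matrix

/-- First partial derivative `∂f/∂θ₁` of `f : ℝ² → ℝ`. -/
noncomputable def D1 (f : ℝ × ℝ → ℝ) (x : ℝ × ℝ) : ℝ := deriv (fun t => f (t, x.2)) x.1

/-- Second partial derivative `∂f/∂θ₂` of `f : ℝ² → ℝ`. -/
noncomputable def D2 (f : ℝ × ℝ → ℝ) (x : ℝ × ℝ) : ℝ := deriv (fun t => f (x.1, t)) x.2

/-- Gradient vector `∇f(x)` of `f : ℝ² → ℝ`. -/
noncomputable def gradv (f : ℝ × ℝ → ℝ) (x : ℝ × ℝ) : Fin 2 → ℝ := ![D1 f x, D2 f x]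

/-- Hessian matrix `Hf(x)` of `f : ℝ² → ℝ`, with entries `u = ∂²f/∂θ₁²`,
`v = ∂²f/∂θ₁∂θ₂`, `w = ∂²f/∂θ₂²`. -/
noncomputable def hess (f : ℝ × ℝ → ℝ) (x : ℝ × ℝ) : Matrix (Fin 2) (Fin 2) ℝ :=
  !![D1 (D1 f) x, D1 (D2 f) x; D1 (D2 f) x, D2 (D2 f) x]

/-- `s(x) = √((u − w)² + 4v²)`. -/
noncomputable def sfun (f : ℝ × ℝ → ℝ) (x : ℝ × ℝ) : ℝ :=
  Real.sqrt ((D1 (D1 f) x - D2 (D2 f) x) ^ 2 + 4 * (D1 (D2 f) x) ^ 2)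

/-- Largest eigenvalue `λ₁(x) = (u + w + s(x))/2` of the Hessian of `f` at `x`. -/
noncomputable def lam1 (f : ℝ × ℝ → ℝ) (x : ℝ × ℝ) : ℝ :=
  (D1 (D1 f) x + D2 (D2 f) x + sfun f x) / 2

/-- Smallest eigenvalue `λ₂(x) = (u + w − s(x))/2` of the Hessian of `f` at `x`. -/
noncomputable def lam2 (f : ℝ × ℝ → ℝ) (x : ℝ × ℝ) : ℝ :=
  (D1 (D1 f) x + D2 (D2 f) x - sfun f x) / 2

/-- The ridge set `R(f) = {x : Hf(x)·∇f(x) = λ₁(x)·∇f(x), λ₂(x) < 0}`. -/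
noncomputable def Ridge (f : ℝ × ℝ → ℝ) : Set (ℝ × ℝ) :=
  {x | (hess f x).mulVec (gradv f x) = lam1 f x • gradv f x ∧ lam2 f x < 0}

/-- The partial derivative in `θ₁` of the unnormalized bivariate sine von Mises density. -/
lemma hasDerivAt_fst_vonMises {κ lam : ℝ} {f : ℝ × ℝ → ℝ}
    (hf : ∀ x : ℝ × ℝ, f x = Real.exp (κ * Real.cos x.1 + κ * Real.cos x.2 +
      lam * Real.sin x.1 * Real.sin x.2)) (x : ℝ × ℝ) :
    HasDerivAt (fun t => f (t, x.2))
      ((lam * Real.cos x.1 * Real.sin x.2 - κ * Real.sin x.1) * f x) x.1 := by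
  simp only [hf]
  refine (((((Real.hasDerivAt_cos x.1).const_mul κ).add_const (κ * Real.cos x.2)).add
    (((Real.hasDerivAt_sin x.1).const_mul lam).mul_const (Real.sin x.2))).exp).congr_deriv ?_
  dsimp
  ring

/-- The partial derivative in `θ₂` of the unnormalized bivariate sine von Mises density. -/
lemma hasDerivAt_snd_vonMises {κ lam : ℝ} {f : ℝ × ℝ → ℝ}
    (hf : ∀ x : ℝ × ℝ, f x = Real.exp (κ * Real.cos x.1 + κ * Real.cos x.2 +
      lam * Real.sin x.1 * Real.sin x.2)) (x : ℝ × ℝ) :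
    HasDerivAt (fun t => f (x.1, t))
      ((lam * Real.sin x.1 * Real.cos x.2 - κ * Real.sin x.2) * f x) x.2 := by
  simp only [hf]
  refine (((((Real.hasDerivAt_cos x.2).const_mul κ).const_add (κ * Real.cos x.1)).add
    ((Real.hasDerivAt_sin x.2).const_mul (lam * Real.sin x.1))).exp).congr_deriv ?_
  dsimp
  ring

theorem stmt8 (κ lam : ℝ) (hκ : 0 ≤ κ) (hlam : 0 < lam) (f : ℝ × ℝ → ℝ)
    (hf : ∀ x : ℝ × ℝ,
      f x = Real.exp (κ * Real.cos x.1 + κ * Real.cos x.2 +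
        lam * Real.sin x.1 * Real.sin x.2)) :
    ∀ θ : ℝ,
      D1 f (θ, θ) = D2 f (θ, θ) ∧
      D1 (D1 f) (θ, θ) = D2 (D2 f) (θ, θ) ∧
      (D1 (D2 f) (θ, θ) =
        (lam * Real.cos θ ^ 2 + (lam * Real.sin θ * Real.cos θ - κ * Real.sin θ) ^ 2) *
          f (θ, θ) ∧
        0 ≤ D1 (D2 f) (θ, θ)) ∧
      (hess f (θ, θ)).mulVec (gradv f (θ, θ)) = lam1 f (θ, θ) • gradv f (θ, θ) := by
  intro θ
  have h1 : D1 f = fun x => (lam * Real.cos x.1 * Real.sin x.2 - κ * Real.sin x.1) * f x :=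
    funext fun x => (hasDerivAt_fst_vonMises hf x).deriv
  have h2 : D2 f = fun x => (lam * Real.sin x.1 * Real.cos x.2 - κ * Real.sin x.2) * f x :=
    funext fun x => (hasDerivAt_snd_vonMises hf x).deriv
  have hgrad : D1 f (θ, θ) = D2 f (θ, θ) := by
    simp only [h1, h2]
    ring
  have h11 : D1 (D1 f) (θ, θ) = (-(lam * Real.sin θ * Real.sin θ) - κ * Real.cos θ +
      (lam * Real.sin θ * Real.cos θ - κ * Real.sin θ) ^ 2) * f (θ, θ) := by
    rw [h1]
    refine HasDerivAt.deriv
      ((((((Real.hasDerivAt_cos θ).const_mul lam).mul_const (Real.sin θ)).sub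
      ((Real.hasDerivAt_sin θ).const_mul κ)).mul (hasDerivAt_fst_vonMises hf (θ, θ))).congr_deriv ?_)
    dsimp
    ring
  have h22 : D2 (D2 f) (θ, θ) = (-(lam * Real.sin θ * Real.sin θ) - κ * Real.cos θ +
      (lam * Real.sin θ * Real.cos θ - κ * Real.sin θ) ^ 2) * f (θ, θ) := by
    rw [h2]
    refine HasDerivAt.deriv
      (((((Real.hasDerivAt_cos θ).const_mul (lam * Real.sin θ)).sub
      ((Real.hasDerivAt_sin θ).const_mul κ)).mul (hasDerivAt_snd_vonMises hf (θ, θ))).congr_deriv ?_)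
    dsimp
    ring
  have h12 : D1 (D2 f) (θ, θ) = (lam * Real.cos θ ^ 2 +
      (lam * Real.sin θ * Real.cos θ - κ * Real.sin θ) ^ 2) * f (θ, θ) := by
    rw [h2]
    refine HasDerivAt.deriv
      ((((((Real.hasDerivAt_sin θ).const_mul lam).mul_const (Real.cos θ)).sub_const
      (κ * Real.sin θ)).mul (hasDerivAt_fst_vonMises hf (θ, θ))).congr_deriv ?_)
    dsimp
    ring
  have hnonneg : 0 ≤ D1 (D2 f) (θ, θ) := by
    rw [h12, hf]
    positivity
  have hdiag : D1 (D1 f) (θ, θ) = D2 (D2 f) (θ, θ) := h11.trans h22.symm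
  have hs : sfun f (θ, θ) = 2 * D1 (D2 f) (θ, θ) := by
    rw [sfun, hdiag, ← Real.sqrt_sq (mul_nonneg zero_le_two hnonneg)]
    congr 1
    ring
  refine ⟨hgrad, hdiag, ⟨h12, hnonneg⟩, ?_⟩
  ext i
  fin_cases i <;>
    simp [hess, gradv, lam1, hs, hgrad, hdiag, Matrix.mulVec, dotProduct, Fin.sum_univ_two] <;>
    ring
end

section
/- Let κ ≥ 0 and λ > 0, and define f : ℝ² → ℝ by f(θ₁, θ₂) = exp(κ cos θ₁ + κ cos θ₂ + λ sin θ₁ sin θ₂). Then for every θ ∈ ℝ, the smallest eigenvalue of the Hessian of f at the diagonal point (θ, θ) equals λ₂(θ, θ) = −(κ cos θ + λ)·exp(2κ cos θ + λ sin²θ). In particular, λ₂(θ, θ) < 0 if and only if κ cos θ + λ > 0. -/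
open Real Matrix

/-- The function `exp (κ cos a + κ cos b + c sin a sin b)` has the expected derivative in `a`. -/
theorem hasDerivAt_exp_cos_add_sin (κ c a b : ℝ) :
    HasDerivAt (fun t => Real.exp (κ * Real.cos t + κ * Real.cos b + c * Real.sin t * Real.sin b))
      (Real.exp (κ * Real.cos a + κ * Real.cos b + c * Real.sin a * Real.sin b) *
        (-κ * Real.sin a + c * Real.cos a * Real.sin b)) a := by
  have h := (((((Real.hasDerivAt_cos a).const_mul κ).add_const (κ * Real.cos b)).add
    (((Real.hasDerivAt_sin a).const_mul c).mul_const (Real.sin b)))).exp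
  exact HasDerivAt.congr_deriv
    (f' := Real.exp (κ * Real.cos a + κ * Real.cos b + c * Real.sin a * Real.sin b) *
      (κ * -Real.sin a + c * Real.cos a * Real.sin b)) h (by ring)

/-- The same function has the expected derivative in `b`. -/
theorem hasDerivAt_exp_cos_add_sin_right (κ c a b : ℝ) :
    HasDerivAt (fun t => Real.exp (κ * Real.cos a + κ * Real.cos t + c * Real.sin a * Real.sin t))
      (Real.exp (κ * Real.cos a + κ * Real.cos b + c * Real.sin a * Real.sin b) *
        (-κ * Real.sin b + c * Real.cos b * Real.sin a)) b := by
  convert hasDerivAt_exp_cos_add_sin κ c b a using 1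
  · ext t
    ring_nf
  · ring_nf

theorem stmt9 (κ lam : ℝ) (hκ : 0 ≤ κ) (hlam : 0 < lam) (f : ℝ × ℝ → ℝ)
    (hf : ∀ x : ℝ × ℝ,
      f x = Real.exp (κ * Real.cos x.1 + κ * Real.cos x.2 +
        lam * Real.sin x.1 * Real.sin x.2)) :
    ∀ θ : ℝ,
      lam2 f (θ, θ) =
        -(κ * Real.cos θ + lam) * Real.exp (2 * κ * Real.cos θ + lam * Real.sin θ ^ 2) ∧
      (lam2 f (θ, θ) < 0 ↔ 0 < κ * Real.cos θ + lam) := by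
  obtain rfl : f = fun x => Real.exp (κ * Real.cos x.1 + κ * Real.cos x.2 +
      lam * Real.sin x.1 * Real.sin x.2) := funext hf
  intro θ
  have h1 : D1 (fun x => Real.exp (κ * Real.cos x.1 + κ * Real.cos x.2 +
      lam * Real.sin x.1 * Real.sin x.2)) = fun x => Real.exp (κ * Real.cos x.1 +
        κ * Real.cos x.2 + lam * Real.sin x.1 * Real.sin x.2) *
        (-κ * Real.sin x.1 + lam * Real.cos x.1 * Real.sin x.2) :=
    funext fun x => (hasDerivAt_exp_cos_add_sin κ lam x.1 x.2).deriv
  have h2 : D2 (fun x => Real.exp (κ * Real.cos x.1 + κ * Real.cos x.2 +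
      lam * Real.sin x.1 * Real.sin x.2)) = fun x => Real.exp (κ * Real.cos x.1 +
        κ * Real.cos x.2 + lam * Real.sin x.1 * Real.sin x.2) *
        (-κ * Real.sin x.2 + lam * Real.cos x.2 * Real.sin x.1) :=
    funext fun x => (hasDerivAt_exp_cos_add_sin_right κ lam x.1 x.2).deriv
  have linear (p q : ℝ) : HasDerivAt (fun t => -κ * Real.sin t + lam * Real.cos t * q)
      (-κ * Real.cos p - lam * Real.sin p * q) p := by
    have h := ((Real.hasDerivAt_sin p).const_mul (-κ)).add
      (((Real.hasDerivAt_cos p).const_mul lam).mul_const q)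
    exact HasDerivAt.congr_deriv h (by ring)
  have mixed : HasDerivAt (fun t => -κ * Real.sin θ + lam * Real.cos θ * Real.sin t)
      (lam * Real.cos θ * Real.cos θ) θ :=
    ((Real.hasDerivAt_sin θ).const_mul (lam * Real.cos θ)).const_add _
  have huu := ((hasDerivAt_exp_cos_add_sin κ lam θ θ).mul (linear θ (Real.sin θ))).deriv
  have hww := ((hasDerivAt_exp_cos_add_sin_right κ lam θ θ).mul (linear θ (Real.sin θ))).deriv
  have huv := ((hasDerivAt_exp_cos_add_sin κ lam θ θ).mul mixed).deriv
  set E := Real.exp (2 * κ * Real.cos θ + lam * Real.sin θ ^ 2)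
  have hexp : Real.exp (κ * Real.cos θ + κ * Real.cos θ + lam * Real.sin θ * Real.sin θ) = E := by
    exact congrArg Real.exp (by ring)
  have hpos : 0 < E := Real.exp_pos _
  rw [hexp] at huu hww huv
  have hlam2 : lam2 (fun x => Real.exp (κ * Real.cos x.1 + κ * Real.cos x.2 +
      lam * Real.sin x.1 * Real.sin x.2)) (θ, θ) = -(κ * Real.cos θ + lam) * E := by
    unfold lam2 sfun
    rw [h1, h2]
    unfold D1 D2
    erw [huu, hww, huv]
    set G := -κ * Real.sin θ + lam * Real.cos θ * Real.sin θ
    have hv : 0 ≤ 2 * (E * (G ^ 2 + lam * Real.cos θ ^ 2)) := by positivity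
    have hsqrt := Real.sqrt_sq hv
    rw [show ∀ u v : ℝ, (u - u) ^ 2 + 4 * v ^ 2 = (2 * v) ^ 2 by intros; ring,
      show E * G * G + E * (lam * Real.cos θ * Real.cos θ) =
        E * (G ^ 2 + lam * Real.cos θ ^ 2) by ring, hsqrt]
    linear_combination (-E * lam) * Real.sin_sq_add_cos_sq θ
  refine ⟨hlam2, ?_⟩
  rw [hlam2, neg_mul, neg_lt_zero, mul_pos_iff_of_pos_right hpos]
end

section
/- Let κ ≥ 0 and λ > 0, and define f : ℝ² → ℝ by f(θ₁, θ₂) = exp(κ cos θ₁ + κ cos θ₂ + λ sin θ₁ sin θ₂) (the unnormalized zero-centered bivariate sine von Mises density with κ₁ = κ₂ = κ). Then the diagonal portion {(θ, θ) : θ ∈ ℝ, κ cos θ + λ > 0} is contained in the ridge set R(f). In particular, if κ < λ, the entire diagonal {(θ, θ) : θ ∈ ℝ} is contained in R(f). -/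
open Real Matrix

lemma D1_eq_of_hasDerivAt {f g : ℝ × ℝ → ℝ}
    (h : ∀ a b, HasDerivAt (fun t => f (t, b)) (g (a, b)) a) : D1 f = g :=
  funext fun x => (h x.1 x.2).deriv

lemma D2_eq_of_hasDerivAt {f g : ℝ × ℝ → ℝ}
    (h : ∀ a b, HasDerivAt (fun t => f (a, t)) (g (a, b)) b) : D2 f = g :=
  funext fun x => (h x.1 x.2).deriv

/-- If both first partials agree, both pure second partials agree, and the mixed partial is
nonnegative, then `(1, 1)` spans the leading eigenspace direction, which contains the gradient. -/
lemma mem_Ridge_of_symmetric {f : ℝ × ℝ → ℝ} {x : ℝ × ℝ} (hgrad : D1 f x = D2 f x)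
    (hdiag : D1 (D1 f) x = D2 (D2 f) x) (hmixed : 0 ≤ D1 (D2 f) x)
    (hlt : D2 (D2 f) x < D1 (D2 f) x) : x ∈ Ridge f := by
  have hs : sfun f x = 2 * D1 (D2 f) x := by
    rw [sfun, hdiag, show (D2 (D2 f) x - D2 (D2 f) x) ^ 2 + 4 * D1 (D2 f) x ^ 2 =
      (2 * D1 (D2 f) x) ^ 2 by ring]
    exact Real.sqrt_sq (by positivity)
  refine ⟨?_, ?_⟩
  · ext i
    fin_cases i <;>
      simp [hess, gradv, lam1, hs, hgrad, hdiag, Matrix.mulVec, dotProduct, Fin.sum_univ_two] <;>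
      ring
  · rw [lam2, hs, hdiag]
    linarith

section SineVonMises

variable (κ lam : ℝ)

/-- The unnormalized bivariate sine von Mises density with equal concentrations. -/
noncomputable def sineVonMises (x : ℝ × ℝ) : ℝ :=
  Real.exp (κ * Real.cos x.1 + κ * Real.cos x.2 + lam * Real.sin x.1 * Real.sin x.2)

lemma hasDerivAt_sineVonMises_fst (a b : ℝ) :
    HasDerivAt (fun t => sineVonMises κ lam (t, b))
      (sineVonMises κ lam (a, b) * (-κ * Real.sin a + lam * Real.cos a * Real.sin b)) a := by
  have h := ((((Real.hasDerivAt_cos a).const_mul κ).add_const (κ * Real.cos b)).add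
    (((Real.hasDerivAt_sin a).const_mul lam).mul_const (Real.sin b))).exp
  refine h.congr_deriv ?_
  simp [sineVonMises]

lemma hasDerivAt_sineVonMises_snd (a b : ℝ) :
    HasDerivAt (fun t => sineVonMises κ lam (a, t))
      (sineVonMises κ lam (a, b) * (-κ * Real.sin b + lam * Real.sin a * Real.cos b)) b := by
  have h := ((((Real.hasDerivAt_cos b).const_mul κ).const_add (κ * Real.cos a)).add
    ((Real.hasDerivAt_sin b).const_mul (lam * Real.sin a))).exp
  refine h.congr_deriv ?_
  simp [sineVonMises]

lemma D1_sineVonMises : D1 (sineVonMises κ lam) = fun x => sineVonMises κ lam x *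
    (-κ * Real.sin x.1 + lam * Real.cos x.1 * Real.sin x.2) :=
  D1_eq_of_hasDerivAt (hasDerivAt_sineVonMises_fst κ lam)

lemma D2_sineVonMises : D2 (sineVonMises κ lam) = fun x => sineVonMises κ lam x *
    (-κ * Real.sin x.2 + lam * Real.sin x.1 * Real.cos x.2) :=
  D2_eq_of_hasDerivAt (hasDerivAt_sineVonMises_snd κ lam)

lemma D1_D1_sineVonMises : D1 (D1 (sineVonMises κ lam)) = fun x => sineVonMises κ lam x *
    ((-κ * Real.sin x.1 + lam * Real.cos x.1 * Real.sin x.2) ^ 2 +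
      (-κ * Real.cos x.1 - lam * Real.sin x.1 * Real.sin x.2)) := by
  rw [D1_sineVonMises]
  refine D1_eq_of_hasDerivAt fun a b => ?_
  have h := (hasDerivAt_sineVonMises_fst κ lam a b).mul
    (((Real.hasDerivAt_sin a).const_mul (-κ)).add
      (((Real.hasDerivAt_cos a).const_mul lam).mul_const (Real.sin b)))
  refine h.congr_deriv ?_
  simp only [Pi.add_apply]
  ring

lemma D1_D2_sineVonMises : D1 (D2 (sineVonMises κ lam)) = fun x => sineVonMises κ lam x *
    ((-κ * Real.sin x.1 + lam * Real.cos x.1 * Real.sin x.2) *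
      (-κ * Real.sin x.2 + lam * Real.sin x.1 * Real.cos x.2) +
      lam * Real.cos x.1 * Real.cos x.2) := by
  rw [D2_sineVonMises]
  refine D1_eq_of_hasDerivAt fun a b => ?_
  have h := (hasDerivAt_sineVonMises_fst κ lam a b).mul
    ((((Real.hasDerivAt_sin a).const_mul lam).mul_const (Real.cos b)).const_add
      (-κ * Real.sin b))
  refine h.congr_deriv ?_
  ring

lemma D2_D2_sineVonMises : D2 (D2 (sineVonMises κ lam)) = fun x => sineVonMises κ lam x *
    ((-κ * Real.sin x.2 + lam * Real.sin x.1 * Real.cos x.2) ^ 2 +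
      (-κ * Real.cos x.2 - lam * Real.sin x.1 * Real.sin x.2)) := by
  rw [D2_sineVonMises]
  refine D2_eq_of_hasDerivAt fun a b => ?_
  have h := (hasDerivAt_sineVonMises_snd κ lam a b).mul
    (((Real.hasDerivAt_sin b).const_mul (-κ)).add
      ((Real.hasDerivAt_cos b).const_mul (lam * Real.sin a)))
  refine h.congr_deriv ?_
  simp only [Pi.add_apply]
  ring

lemma diagonal_mem_Ridge_sineVonMises {κ lam θ : ℝ} (hlam : 0 ≤ lam)
    (hθ : 0 < κ * Real.cos θ + lam) : ((θ, θ) : ℝ × ℝ) ∈ Ridge (sineVonMises κ lam) := by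
  have hpos : 0 < sineVonMises κ lam (θ, θ) := Real.exp_pos _
  apply mem_Ridge_of_symmetric
  · simp only [D1_sineVonMises, D2_sineVonMises]
    ring
  · simp only [D1_D1_sineVonMises, D2_D2_sineVonMises]
    ring
  · simp only [D1_D2_sineVonMises]
    refine mul_nonneg hpos.le ?_
    linarith [sq_nonneg (-κ * Real.sin θ + lam * Real.cos θ * Real.sin θ),
      mul_nonneg hlam (sq_nonneg (Real.cos θ))]
  · simp only [D1_D2_sineVonMises, D2_D2_sineVonMises]
    refine mul_lt_mul_of_pos_left ?_ hpos
    linear_combination hθ - lam * Real.sin_sq_add_cos_sq θ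

end SineVonMises

theorem stmt10 (κ lam : ℝ) (hκ : 0 ≤ κ) (hlam : 0 < lam) (f : ℝ × ℝ → ℝ)
    (hf : ∀ x : ℝ × ℝ,
      f x = Real.exp (κ * Real.cos x.1 + κ * Real.cos x.2 +
        lam * Real.sin x.1 * Real.sin x.2)) :
    (∀ θ : ℝ, 0 < κ * Real.cos θ + lam → ((θ, θ) : ℝ × ℝ) ∈ Ridge f) ∧
    (κ < lam → ∀ θ : ℝ, ((θ, θ) : ℝ × ℝ) ∈ Ridge f) := by
  obtain rfl : f = sineVonMises κ lam := funext hf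
  refine ⟨fun θ => diagonal_mem_Ridge_sineVonMises hlam.le, fun hlt θ =>
    diagonal_mem_Ridge_sineVonMises hlam.le ?_⟩
  linarith [mul_le_mul_of_nonneg_left (Real.neg_one_le_cos θ) hκ]
end

section
/- Let ξ ∈ (0, 1) and define f : ℝ² → ℝ by f(θ₁, θ₂) = (1 + ξ² − 2ξ cos θ₂)⁻¹ (the unnormalized zero-centered bivariate wrapped Cauchy density with ξ₁ = 0, ξ₂ = ξ, and ρ = 0; note 1 + ξ² − 2ξ cos θ₂ ≥ (1 − ξ)² > 0). Then the ridge set of f is exactly R(f) = {(θ₁, 2πk) : θ₁ ∈ ℝ, k ∈ ℤ}, and the connected component of R(f) containing the origin (0, 0) is the horizontal line {(θ₁, 0) : θ₁ ∈ ℝ}. -/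
open Real Matrix

lemma D1_comp_snd (g : ℝ → ℝ) : D1 (fun x => g x.2) = fun _ => 0 := by
  funext x
  simp [D1]

lemma D2_comp_snd (g : ℝ → ℝ) : D2 (fun x => g x.2) = fun x => deriv g x.2 := rfl

/-- The ridge set of a function of the second coordinate alone. -/
lemma Ridge_comp_snd (g : ℝ → ℝ) :
    Ridge (fun x => g x.2) = {x | deriv g x.2 = 0 ∧ deriv (deriv g) x.2 < 0} := by
  have h11 : D1 (fun _ : ℝ × ℝ => (0 : ℝ)) = fun _ => 0 := D1_comp_snd fun _ => 0
  ext x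
  simp only [Ridge, hess, gradv, lam1, lam2, sfun, D1_comp_snd, D2_comp_snd, h11,
    Set.mem_ofPred_eq]
  generalize deriv (deriv g) x.2 = w
  generalize deriv g x.2 = d
  have hs : √((0 - w) ^ 2 + 4 * (0 : ℝ) ^ 2) = |w| := by
    rw [← Real.sqrt_sq_eq_abs]
    congr 1
    ring
  rw [hs]
  have hw : (0 + w - |w|) / 2 < 0 ↔ w < 0 := by
    constructor
    · intro h
      by_contra! hw
      rw [abs_of_nonneg hw] at h
      linarith
    · intro h
      rw [abs_of_neg h]
      linarith
  rw [hw]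
  refine and_congr_left fun h => ?_
  rw [abs_of_neg h]
  constructor
  · intro he
    have := congrFun he 1
    simpa [Matrix.mulVec, dotProduct, h.ne] using this
  · rintro rfl
    funext i
    fin_cases i <;> simp [Matrix.mulVec, dotProduct]

section WrappedCauchy

variable {ξ : ℝ}

lemma wrappedCauchy_denom_pos (hξ0 : 0 < ξ) (hξ1 : ξ < 1) (t : ℝ) :
    0 < 1 + ξ ^ 2 - 2 * ξ * cos t := by
  nlinarith [cos_le_one t, sq_pos_of_pos (sub_pos.2 hξ1)]

lemma hasDerivAt_wrappedCauchy_denom (t : ℝ) :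
    HasDerivAt (fun t => 1 + ξ ^ 2 - 2 * ξ * cos t) (2 * ξ * sin t) t := by
  simpa using ((hasDerivAt_cos t).const_mul (2 * ξ)).const_sub (1 + ξ ^ 2)

lemma deriv_wrappedCauchy (hξ0 : 0 < ξ) (hξ1 : ξ < 1) :
    deriv (fun t => (1 + ξ ^ 2 - 2 * ξ * cos t)⁻¹) =
      fun t => -(2 * ξ * sin t) / (1 + ξ ^ 2 - 2 * ξ * cos t) ^ 2 := by
  funext t
  exact ((hasDerivAt_wrappedCauchy_denom t).fun_inv (wrappedCauchy_denom_pos hξ0 hξ1 t).ne').deriv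

lemma deriv_deriv_wrappedCauchy_of_sin_eq_zero (hξ0 : 0 < ξ) (hξ1 : ξ < 1) {t : ℝ}
    (ht : sin t = 0) :
    deriv (deriv fun t => (1 + ξ ^ 2 - 2 * ξ * cos t)⁻¹) t =
      -(2 * ξ * cos t) / (1 + ξ ^ 2 - 2 * ξ * cos t) ^ 2 := by
  have hq := (wrappedCauchy_denom_pos hξ0 hξ1 t).ne'
  rw [deriv_wrappedCauchy hξ0 hξ1]
  have h := (((hasDerivAt_sin t).const_mul (2 * ξ)).fun_neg).fun_div
    ((hasDerivAt_wrappedCauchy_denom (ξ := ξ) t).fun_pow 2) (pow_ne_zero 2 hq)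
  rw [h.deriv, ht]
  field_simp
  ring

lemma Ridge_wrappedCauchy (hξ0 : 0 < ξ) (hξ1 : ξ < 1) :
    Ridge (fun x => (1 + ξ ^ 2 - 2 * ξ * cos x.2)⁻¹) =
      {x : ℝ × ℝ | ∃ k : ℤ, x.2 = 2 * π * k} := by
  rw [Ridge_comp_snd fun t => (1 + ξ ^ 2 - 2 * ξ * cos t)⁻¹]
  ext ⟨a, t⟩
  have hq := wrappedCauchy_denom_pos hξ0 hξ1 t
  have hsin : deriv (fun t => (1 + ξ ^ 2 - 2 * ξ * cos t)⁻¹) t = 0 ↔ sin t = 0 := by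
    rw [deriv_wrappedCauchy hξ0 hξ1]
    simp [hq.ne', hξ0.ne']
  have hcos : (∃ k : ℤ, t = 2 * π * k) ↔ cos t = 1 := by
    rw [cos_eq_one_iff]
    exact exists_congr fun k => by rw [eq_comm, mul_comm]
  simp only [Set.mem_ofPred_eq]
  rw [hsin, hcos]
  constructor
  · rintro ⟨hs, hneg⟩
    rw [deriv_deriv_wrappedCauchy_of_sin_eq_zero hξ0 hξ1 hs, div_lt_iff₀ (by positivity)] at hneg
    rcases sin_eq_zero_iff_cos_eq.1 hs with h | h
    · exact h
    · rw [h] at hneg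
      linarith
  · intro h
    have hs : sin t = 0 := sin_eq_zero_iff_cos_eq.2 (Or.inl h)
    refine ⟨hs, ?_⟩
    rw [deriv_deriv_wrappedCauchy_of_sin_eq_zero hξ0 hξ1 hs, div_lt_iff₀ (by positivity), h]
    linarith

end WrappedCauchy

/-- In a union of countably many horizontal lines, the component of a point is its line. -/
lemma connectedComponentIn_snd_preimage {S : Set ℝ} (hS : S.Countable) {p : ℝ × ℝ}
    (hp : p.2 ∈ S) : connectedComponentIn (Prod.snd ⁻¹' S) p = {x | x.2 = p.2} := by
  apply Set.Subset.antisymm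
  · intro x hx
    refine hS.isTotallyDisconnected (Prod.snd '' connectedComponentIn (Prod.snd ⁻¹' S) p) ?_
      (isPreconnected_connectedComponentIn.image _ continuous_snd.continuousOn)
      (Set.mem_image_of_mem _ hx) (Set.mem_image_of_mem _ (mem_connectedComponentIn hp))
    exact Set.image_subset_iff.2 (connectedComponentIn_subset _ _)
  · refine IsPreconnected.subset_connectedComponentIn ?_ rfl ?_
    · exact ((convex_singleton p.2).is_linear_preimage
        (LinearMap.snd ℝ ℝ ℝ).isLinear).isPreconnected
    · intro x hx
      rwa [Set.mem_preimage, show x.2 = p.2 from hx]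

theorem stmt11 (ξ : ℝ) (hξ0 : 0 < ξ) (hξ1 : ξ < 1) (f : ℝ × ℝ → ℝ)
    (hf : ∀ x : ℝ × ℝ, f x = (1 + ξ ^ 2 - 2 * ξ * Real.cos x.2)⁻¹) :
    Ridge f = {x : ℝ × ℝ | ∃ k : ℤ, x.2 = 2 * π * k} ∧
    connectedComponentIn (Ridge f) ((0, 0) : ℝ × ℝ) = {x : ℝ × ℝ | x.2 = 0} := by
  obtain rfl : f = fun x => (1 + ξ ^ 2 - 2 * ξ * cos x.2)⁻¹ := funext hf
  have hR := Ridge_wrappedCauchy hξ0 hξ1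
  refine ⟨hR, ?_⟩
  rw [hR]
  have hS : {t : ℝ | ∃ k : ℤ, t = 2 * π * k}.Countable := by
    refine (Set.countable_range fun k : ℤ => 2 * π * (k : ℝ)).mono ?_
    rintro t ⟨k, rfl⟩
    exact ⟨k, rfl⟩
  exact connectedComponentIn_snd_preimage hS (p := (0, 0)) ⟨0, by simp⟩
end

section
/- Let ξ ∈ [0, 1) and ρ ∈ (0, 1), set c₀ = (1 + ρ²)(1 + ξ²)² − 8ρξ², c₁ = 2(1 + ρ²)ξ(1 + ξ²) − 4ρ(1 + ξ²)ξ, c₃ = −4(1 + ρ²)ξ² + 2ρ(1 + ξ²)², c₄ = 2ρ(1 − ξ²)², and A(θ₁, θ₂) = c₀ − c₁(cos θ₁ + cos θ₂) − c₃ cos θ₁ cos θ₂ − c₄ sin θ₁ sin θ₂. Assume A(θ₁, θ₂) > 0 for all (θ₁, θ₂) ∈ ℝ², and define f = 1/A (the unnormalized zero-centered bivariate wrapped Cauchy density with ξ₁ = ξ₂ = ξ). Then for every θ ∈ ℝ, at the diagonal point (θ, θ): (i) ∂f/∂θ₁(θ, θ) = ∂f/∂θ₂(θ, θ); (ii) ∂²f/∂θ₁²(θ,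 θ) = ∂²f/∂θ₂²(θ, θ); and (iii) if moreover ∂²f/∂θ₁∂θ₂(θ, θ) ≥ 0, then Hf(θ, θ)·∇f(θ, θ) = λ₁(θ, θ)·∇f(θ, θ), i.e., the gradient at (θ, θ) lies in the eigenspace of the largest Hessian eigenvalue. -/
open Real Matrix

/-- Partial derivatives of swapped functions are swapped. -/
theorem D1_eq_D2_swap {g h : ℝ × ℝ → ℝ} (hgh : ∀ x, g x = h x.swap) (x : ℝ × ℝ) :
    D1 g x = D2 h x.swap := by
  simp [D1, D2, hgh]

/-- At a point where both first partials and both pure second partials agree and the mixed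
partial is nonnegative, the gradient is an eigenvector of the Hessian for `lam1`. -/
theorem hess_mulVec_gradv_eq_lam1_smul {f : ℝ × ℝ → ℝ} {x : ℝ × ℝ} (hg : D1 f x = D2 f x)
    (hh : D1 (D1 f) x = D2 (D2 f) x) (hv : 0 ≤ D1 (D2 f) x) :
    (hess f x).mulVec (gradv f x) = lam1 f x • gradv f x := by
  have hs : sfun f x = 2 * D1 (D2 f) x := by
    rw [sfun, hh, ← Real.sqrt_sq (mul_nonneg zero_le_two hv)]
    congr 1
    ring
  ext i
  fin_cases i <;> simp [hess, gradv, lam1, hs, hg, hh, Matrix.mulVec, dotProduct] <;> ring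

theorem stmt12 (ξ ρ : ℝ) (hξ0 : 0 ≤ ξ) (hξ1 : ξ < 1) (hρ0 : 0 < ρ) (hρ1 : ρ < 1)
    (c0 c1 c3 c4 : ℝ)
    (hc0 : c0 = (1 + ρ ^ 2) * (1 + ξ ^ 2) ^ 2 - 8 * ρ * ξ ^ 2)
    (hc1 : c1 = 2 * (1 + ρ ^ 2) * ξ * (1 + ξ ^ 2) - 4 * ρ * (1 + ξ ^ 2) * ξ)
    (hc3 : c3 = -4 * (1 + ρ ^ 2) * ξ ^ 2 + 2 * ρ * (1 + ξ ^ 2) ^ 2)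
    (hc4 : c4 = 2 * ρ * (1 - ξ ^ 2) ^ 2)
    (A : ℝ × ℝ → ℝ)
    (hA : ∀ x : ℝ × ℝ, A x = c0 - c1 * (Real.cos x.1 + Real.cos x.2) -
      c3 * Real.cos x.1 * Real.cos x.2 - c4 * Real.sin x.1 * Real.sin x.2)
    (hApos : ∀ x : ℝ × ℝ, 0 < A x)
    (f : ℝ × ℝ → ℝ) (hf : ∀ x : ℝ × ℝ, f x = (A x)⁻¹) :
    ∀ θ : ℝ,
      D1 f (θ, θ) = D2 f (θ, θ) ∧
      D1 (D1 f) (θ, θ) = D2 (D2 f) (θ, θ) ∧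
      (0 ≤ D1 (D2 f) (θ, θ) →
        (hess f (θ, θ)).mulVec (gradv f (θ, θ)) = lam1 f (θ, θ) • gradv f (θ, θ)) := by
  intro θ
  have hsymm : ∀ x, f x = f x.swap := fun x => by
    simp only [hf, hA, Prod.fst_swap, Prod.snd_swap]
    ring
  have hg := D1_eq_D2_swap hsymm
  have hg' : D1 f (θ, θ) = D2 f (θ, θ) := hg (θ, θ)
  have hh' : D1 (D1 f) (θ, θ) = D2 (D2 f) (θ, θ) := D1_eq_D2_swap hg (θ, θ)
  exact ⟨hg', hh', hess_mulVec_gradv_eq_lam1_smul hg' hh'⟩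
end

section
/- Let ξ ∈ [0, 1) and ρ ∈ (0, 1), set c₀ = (1 + ρ²)(1 + ξ²)² − 8ρξ², c₁ = 2(1 + ρ²)ξ(1 + ξ²) − 4ρ(1 + ξ²)ξ, c₃ = −4(1 + ρ²)ξ² + 2ρ(1 + ξ²)², c₄ = 2ρ(1 − ξ²)², and A(θ₁, θ₂) = c₀ − c₁(cos θ₁ + cos θ₂) − c₃ cos θ₁ cos θ₂ − c₄ sin θ₁ sin θ₂. Assume A > 0 everywhere and define f = 1/A. Then for every θ ∈ ℝ: ∂²f/∂θ₁²(θ, θ) − ∂²f/∂θ₁∂θ₂(θ, θ) = −(c₁ cos θ + c₃ + c₄)/A(θ, θ)². Consequently, if ∂²f/∂θ₁∂θ₂(θ, θ) ≥ 0, then the smallest eigenvalue of the Hessian of f at (θ, θ) equals −(c₁ cos θ + c₃ + c₄)/A(θ, θ)², and it is strictly negative if and only if c₁ cos θ + c₃ + c₄ > 0. -/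
/-- Derivative of a reciprocal trigonometric polynomial of degree one. -/
lemma hasDerivAt_inv_trig (a b c t : ℝ) (h : a + b * Real.cos t + c * Real.sin t ≠ 0) :
    HasDerivAt (fun t => (a + b * Real.cos t + c * Real.sin t)⁻¹)
      ((b * Real.sin t - c * Real.cos t) / (a + b * Real.cos t + c * Real.sin t) ^ 2) t := by
  have h₁ := (((Real.hasDerivAt_cos t).const_mul b).const_add a).add
    ((Real.hasDerivAt_sin t).const_mul c)
  refine (h₁.inv h).congr_deriv ?_
  simp only [Pi.add_apply]
  ring

/-- Derivative of a trigonometric polynomial divided by the square of another one. -/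
lemma hasDerivAt_trig_div_sq (p q r a b c t : ℝ)
    (h : a + b * Real.cos t + c * Real.sin t ≠ 0) :
    HasDerivAt (fun t => (p + q * Real.cos t + r * Real.sin t) /
        (a + b * Real.cos t + c * Real.sin t) ^ 2)
      ((r * Real.cos t - q * Real.sin t) / (a + b * Real.cos t + c * Real.sin t) ^ 2 +
        2 * (p + q * Real.cos t + r * Real.sin t) * (b * Real.sin t - c * Real.cos t) /
          (a + b * Real.cos t + c * Real.sin t) ^ 3) t := by
  have h₁ := (((Real.hasDerivAt_cos t).const_mul q).const_add p).add
    ((Real.hasDerivAt_sin t).const_mul r)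
  have h₂ := (((Real.hasDerivAt_cos t).const_mul b).const_add a).add
    ((Real.hasDerivAt_sin t).const_mul c)
  refine (h₁.div (h₂.pow 2) (pow_ne_zero 2 h)).congr_deriv ?_
  simp only [Pi.add_apply, Pi.pow_apply]
  generalize a + b * Real.cos t + c * Real.sin t = d at h ⊢
  push_cast
  field_simp
  ring


open Real Matrix

theorem stmt13 (ξ ρ : ℝ) (hξ0 : 0 ≤ ξ) (hξ1 : ξ < 1) (hρ0 : 0 < ρ) (hρ1 : ρ < 1)
    (c0 c1 c3 c4 : ℝ)
    (hc0 : c0 = (1 + ρ ^ 2) * (1 + ξ ^ 2) ^ 2 - 8 * ρ * ξ ^ 2)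
    (hc1 : c1 = 2 * (1 + ρ ^ 2) * ξ * (1 + ξ ^ 2) - 4 * ρ * (1 + ξ ^ 2) * ξ)
    (hc3 : c3 = -4 * (1 + ρ ^ 2) * ξ ^ 2 + 2 * ρ * (1 + ξ ^ 2) ^ 2)
    (hc4 : c4 = 2 * ρ * (1 - ξ ^ 2) ^ 2)
    (A : ℝ × ℝ → ℝ)
    (hA : ∀ x : ℝ × ℝ, A x = c0 - c1 * (Real.cos x.1 + Real.cos x.2) -
      c3 * Real.cos x.1 * Real.cos x.2 - c4 * Real.sin x.1 * Real.sin x.2)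
    (hApos : ∀ x : ℝ × ℝ, 0 < A x)
    (f : ℝ × ℝ → ℝ) (hf : ∀ x : ℝ × ℝ, f x = (A x)⁻¹) :
    ∀ θ : ℝ,
      D1 (D1 f) (θ, θ) - D1 (D2 f) (θ, θ) =
        -(c1 * Real.cos θ + c3 + c4) / (A (θ, θ)) ^ 2 ∧
      (0 ≤ D1 (D2 f) (θ, θ) →
        lam2 f (θ, θ) = -(c1 * Real.cos θ + c3 + c4) / (A (θ, θ)) ^ 2 ∧
        (lam2 f (θ, θ) < 0 ↔ 0 < c1 * Real.cos θ + c3 + c4)) := by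
  intro θ
  have hA₁ (s t : ℝ) : A (s, t) = (c0 - c1 * Real.cos t) + (-c1 - c3 * Real.cos t) * Real.cos s +
      (-c4 * Real.sin t) * Real.sin s := by rw [hA]; ring
  have hA₂ (s t : ℝ) : A (s, t) = (c0 - c1 * Real.cos s) + (-c1 - c3 * Real.cos s) * Real.cos t +
      (-c4 * Real.sin s) * Real.sin t := by rw [hA]; ring
  have hD1 (s t : ℝ) : D1 f (s, t) =
      ((-c1 - c3 * Real.cos t) * Real.sin s - (-c4 * Real.sin t) * Real.cos s) /
        (A (s, t)) ^ 2 := by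
    have hne := (hApos (s, t)).ne'
    simp only [D1, hf, hA₁] at hne ⊢
    exact (hasDerivAt_inv_trig _ _ _ s hne).deriv
  have hD2 (s t : ℝ) : D2 f (s, t) =
      ((-c1 - c3 * Real.cos s) * Real.sin t - (-c4 * Real.sin s) * Real.cos t) /
        (A (s, t)) ^ 2 := by
    have hne := (hApos (s, t)).ne'
    simp only [D2, hf, hA₂] at hne ⊢
    exact (hasDerivAt_inv_trig _ _ _ t hne).deriv
  have hA0 : A (θ, θ) ≠ 0 := (hApos (θ, θ)).ne'
  set a := A (θ, θ) with ha
  have hD11 : D1 (D1 f) (θ, θ) =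
      ((-c1 - c3 * Real.cos θ) * Real.cos θ - c4 * Real.sin θ * Real.sin θ) / a ^ 2 +
        2 * (c4 * Real.sin θ * Real.cos θ + (-c1 - c3 * Real.cos θ) * Real.sin θ) ^ 2 / a ^ 3 := by
    rw [ha, hA₁] at hA0
    have h := hasDerivAt_trig_div_sq 0 (c4 * Real.sin θ) (-c1 - c3 * Real.cos θ) _ _ _ θ hA0
    rw [← hA₁, ← ha] at h
    rw [D1]
    convert h.deriv using 1
    · congr 1
      funext s
      rw [hD1, ← hA₁]
      ring
    · ring
  have hD22 : D2 (D2 f) (θ, θ) =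
      ((-c1 - c3 * Real.cos θ) * Real.cos θ - c4 * Real.sin θ * Real.sin θ) / a ^ 2 +
        2 * (c4 * Real.sin θ * Real.cos θ + (-c1 - c3 * Real.cos θ) * Real.sin θ) ^ 2 / a ^ 3 := by
    rw [ha, hA₂] at hA0
    have h := hasDerivAt_trig_div_sq 0 (c4 * Real.sin θ) (-c1 - c3 * Real.cos θ) _ _ _ θ hA0
    rw [← hA₂, ← ha] at h
    rw [D2]
    convert h.deriv using 1
    · congr 1
      funext s
      rw [hD2, ← hA₂]
      ring
    · ring
  have hD12 : D1 (D2 f) (θ, θ) =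
      (c4 * Real.cos θ * Real.cos θ + c3 * Real.sin θ * Real.sin θ) / a ^ 2 +
        2 * (c4 * Real.sin θ * Real.cos θ + (-c1 - c3 * Real.cos θ) * Real.sin θ) ^ 2 / a ^ 3 := by
    rw [ha, hA₁] at hA0
    have h := hasDerivAt_trig_div_sq (-c1 * Real.sin θ) (-c3 * Real.sin θ) (c4 * Real.cos θ)
      _ _ _ θ hA0
    rw [← hA₁, ← ha] at h
    rw [D1]
    convert h.deriv using 1
    · congr 1
      funext s
      rw [hD2, ← hA₁]
      ring
    · ring
  have hdiff : D1 (D1 f) (θ, θ) - D1 (D2 f) (θ, θ) =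
      -(c1 * Real.cos θ + c3 + c4) / a ^ 2 := by
    rw [hD11, hD12, add_sub_add_right_eq_sub, ← sub_div]
    congr 1
    linear_combination (-c3 - c4) * Real.sin_sq_add_cos_sq θ
  refine ⟨hdiff, fun hv => ?_⟩
  have hs : sfun f (θ, θ) = 2 * D1 (D2 f) (θ, θ) := by
    rw [sfun, hD22, ← hD11, sub_self, ← Real.sqrt_sq (mul_nonneg zero_le_two hv)]
    congr 1
    ring
  have hlam : lam2 f (θ, θ) = -(c1 * Real.cos θ + c3 + c4) / a ^ 2 := by
    rw [← hdiff, lam2, hs, hD22, ← hD11]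
    ring
  refine ⟨hlam, ?_⟩
  rw [hlam, div_lt_iff₀ (by positivity), zero_mul, neg_lt_zero]
end

section
/- Let ξ ∈ [0, 1) and ρ ∈ (0, 1), set c₀ = (1 + ρ²)(1 + ξ²)² − 8ρξ², c₁ = 2(1 + ρ²)ξ(1 + ξ²) − 4ρ(1 + ξ²)ξ, c₃ = −4(1 + ρ²)ξ² + 2ρ(1 + ξ²)², c₄ = 2ρ(1 − ξ²)², and A(θ₁, θ₂) = c₀ − c₁(cos θ₁ + cos θ₂) − c₃ cos θ₁ cos θ₂ − c₄ sin θ₁ sin θ₂. Assume A > 0 everywhere and define f = 1/A (the unnormalized zero-centered bivariate wrapped Cauchy density with ξ₁ = ξ₂ = ξ). Then every diagonal point (θ, θ) with ∂²f/∂θ₁∂θ₂(θ, θ) ≥ 0 and c₁ cos θ + c₃ + c₄ > 0 belongs to the ridge set R(f). -/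
open Real Matrix

/-- The trigonometric polynomial whose inverse is the bivariate wrapped Cauchy density. -/
noncomputable def trigForm (c0 c1 c3 c4 : ℝ) (x : ℝ × ℝ) : ℝ :=
  c0 - c1 * (Real.cos x.1 + Real.cos x.2) -
    c3 * Real.cos x.1 * Real.cos x.2 - c4 * Real.sin x.1 * Real.sin x.2

/-- The partial derivative of `trigForm c0 c1 c3 c4` in the first variable; by symmetry, the one
in the second variable is obtained by swapping the arguments. -/
noncomputable def trigFormDeriv (c1 c3 c4 a b : ℝ) : ℝ :=
  c1 * Real.sin a + c3 * Real.sin a * Real.cos b - c4 * Real.cos a * Real.sin b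

section

variable {c0 c1 c3 c4 : ℝ}

lemma trigForm_swap (a b : ℝ) : trigForm c0 c1 c3 c4 (a, b) = trigForm c0 c1 c3 c4 (b, a) := by
  simp only [trigForm]
  ring

lemma hasDerivAt_trigForm (a b : ℝ) :
    HasDerivAt (fun t => trigForm c0 c1 c3 c4 (t, b)) (trigFormDeriv c1 c3 c4 a b) a := by
  have hc := Real.hasDerivAt_cos a
  have hs := Real.hasDerivAt_sin a
  have h := ((((hc.add_const (Real.cos b)).const_mul c1).const_sub c0).sub
    ((hc.const_mul c3).mul_const (Real.cos b))).sub ((hs.const_mul c4).mul_const (Real.sin b))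
  refine h.congr_deriv ?_
  simp only [trigFormDeriv]
  ring

lemma hasDerivAt_trigFormDeriv_left (a b : ℝ) :
    HasDerivAt (fun t => trigFormDeriv c1 c3 c4 t b)
      (c1 * Real.cos a + c3 * Real.cos a * Real.cos b + c4 * Real.sin a * Real.sin b) a := by
  have hc := Real.hasDerivAt_cos a
  have hs := Real.hasDerivAt_sin a
  have h := ((hs.const_mul c1).add ((hs.const_mul c3).mul_const (Real.cos b))).sub
    ((hc.const_mul c4).mul_const (Real.sin b))
  refine h.congr_deriv ?_
  ring

lemma hasDerivAt_trigFormDeriv_right (a b : ℝ) :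
    HasDerivAt (fun t => trigFormDeriv c1 c3 c4 a t)
      (-(c3 * Real.sin a * Real.sin b) - c4 * Real.cos a * Real.cos b) b := by
  have h := (((Real.hasDerivAt_cos b).const_mul (c3 * Real.sin a)).const_add
    (c1 * Real.sin a)).sub ((Real.hasDerivAt_sin b).const_mul (c4 * Real.cos a))
  refine h.congr_deriv ?_
  ring

lemma HasDerivAt.neg_div_sq {p q : ℝ → ℝ} {p' q' a : ℝ} (hp : HasDerivAt p p' a)
    (hq : HasDerivAt q q' a) (h0 : q a ≠ 0) :
    HasDerivAt (fun t => -p t / q t ^ 2) (-p' / q a ^ 2 + 2 * p a * q' / q a ^ 3) a := by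
  refine (hp.fun_neg.fun_div (hq.fun_pow 2) (pow_ne_zero 2 h0)).congr_deriv ?_
  field_simp
  ring

lemma D2_D2_inv_trigForm (a b : ℝ) : D2 (D2 (fun x => (trigForm c0 c1 c3 c4 x)⁻¹)) (a, b) =
    D1 (D1 (fun x => (trigForm c0 c1 c3 c4 x)⁻¹)) (b, a) := by
  simp only [D1, D2, trigForm_swap a]

lemma D1_inv_trigForm (hA : ∀ x, 0 < trigForm c0 c1 c3 c4 x) (a b : ℝ) :
    D1 (fun x => (trigForm c0 c1 c3 c4 x)⁻¹) (a, b) =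
    -trigFormDeriv c1 c3 c4 a b / trigForm c0 c1 c3 c4 (a, b) ^ 2 :=
  ((hasDerivAt_trigForm a b).fun_inv (hA _).ne').deriv

lemma D2_inv_trigForm (hA : ∀ x, 0 < trigForm c0 c1 c3 c4 x) (a b : ℝ) :
    D2 (fun x => (trigForm c0 c1 c3 c4 x)⁻¹) (a, b) =
    -trigFormDeriv c1 c3 c4 b a / trigForm c0 c1 c3 c4 (b, a) ^ 2 := by
  rw [← D1_inv_trigForm hA]
  simp only [D1, D2, trigForm_swap a]

lemma D1_D1_inv_trigForm (hA : ∀ x, 0 < trigForm c0 c1 c3 c4 x) (a b : ℝ) :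
    D1 (D1 (fun x => (trigForm c0 c1 c3 c4 x)⁻¹)) (a, b) =
    -(c1 * Real.cos a + c3 * Real.cos a * Real.cos b + c4 * Real.sin a * Real.sin b) /
        trigForm c0 c1 c3 c4 (a, b) ^ 2 +
      2 * trigFormDeriv c1 c3 c4 a b * trigFormDeriv c1 c3 c4 a b /
        trigForm c0 c1 c3 c4 (a, b) ^ 3 := by
  rw [D1]
  simp only [D1_inv_trigForm hA]
  exact ((hasDerivAt_trigFormDeriv_left a b).neg_div_sq (hasDerivAt_trigForm a b)
    (hA _).ne').deriv

lemma D1_D2_inv_trigForm (hA : ∀ x, 0 < trigForm c0 c1 c3 c4 x) (a b : ℝ) :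
    D1 (D2 (fun x => (trigForm c0 c1 c3 c4 x)⁻¹)) (a, b) =
    -(-(c3 * Real.sin b * Real.sin a) - c4 * Real.cos b * Real.cos a) /
        trigForm c0 c1 c3 c4 (a, b) ^ 2 +
      2 * trigFormDeriv c1 c3 c4 b a * trigFormDeriv c1 c3 c4 a b /
        trigForm c0 c1 c3 c4 (a, b) ^ 3 := by
  rw [D1]
  simp only [D2_inv_trigForm hA, trigForm_swap b]
  exact ((hasDerivAt_trigFormDeriv_right b a).neg_div_sq (hasDerivAt_trigForm a b)
    (hA _).ne').deriv

end

/-- A point where both first and both pure second partials agree, the mixed partial is nonnegative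
and exceeds the pure ones, lies on the ridge. -/
lemma diag_mem_ridge {f : ℝ × ℝ → ℝ} {x : ℝ × ℝ} (hg : D1 f x = D2 f x)
    (hu : D1 (D1 f) x = D2 (D2 f) x) (hv : 0 ≤ D1 (D2 f) x)
    (hlt : D1 (D1 f) x - D1 (D2 f) x < 0) : x ∈ Ridge f := by
  have hs : sfun f x = 2 * D1 (D2 f) x := by
    rw [sfun, hu, Real.sqrt_eq_iff_mul_self_eq (by positivity) (by positivity)]
    ring
  constructor
  · ext i
    fin_cases i <;>
      simp [hess, gradv, lam1, Matrix.mulVec, dotProduct, Fin.sum_univ_two, hs, hg, hu] <;> ring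
  · rw [lam2, hs, ← hu]
    linarith

theorem stmt14 (ξ ρ : ℝ) (hξ0 : 0 ≤ ξ) (hξ1 : ξ < 1) (hρ0 : 0 < ρ) (hρ1 : ρ < 1)
    (c0 c1 c3 c4 : ℝ)
    (hc0 : c0 = (1 + ρ ^ 2) * (1 + ξ ^ 2) ^ 2 - 8 * ρ * ξ ^ 2)
    (hc1 : c1 = 2 * (1 + ρ ^ 2) * ξ * (1 + ξ ^ 2) - 4 * ρ * (1 + ξ ^ 2) * ξ)
    (hc3 : c3 = -4 * (1 + ρ ^ 2) * ξ ^ 2 + 2 * ρ * (1 + ξ ^ 2) ^ 2)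
    (hc4 : c4 = 2 * ρ * (1 - ξ ^ 2) ^ 2)
    (A : ℝ × ℝ → ℝ)
    (hA : ∀ x : ℝ × ℝ, A x = c0 - c1 * (Real.cos x.1 + Real.cos x.2) -
      c3 * Real.cos x.1 * Real.cos x.2 - c4 * Real.sin x.1 * Real.sin x.2)
    (hApos : ∀ x : ℝ × ℝ, 0 < A x)
    (f : ℝ × ℝ → ℝ) (hf : ∀ x : ℝ × ℝ, f x = (A x)⁻¹) :
    ∀ θ : ℝ, 0 ≤ D1 (D2 f) (θ, θ) → 0 < c1 * Real.cos θ + c3 + c4 →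
      ((θ, θ) : ℝ × ℝ) ∈ Ridge f := by
  intro θ hv hpos
  obtain rfl : A = trigForm c0 c1 c3 c4 := funext hA
  obtain rfl : f = fun x => (trigForm c0 c1 c3 c4 x)⁻¹ := funext hf
  apply diag_mem_ridge
  · rw [D1_inv_trigForm hApos, D2_inv_trigForm hApos]
  · rw [D2_D2_inv_trigForm]
  · exact hv
  · rw [D1_D1_inv_trigForm hApos, D1_D2_inv_trigForm hApos]
    have hd : 0 < trigForm c0 c1 c3 c4 (θ, θ) := hApos _
    have key : c1 * Real.cos θ + c3 + c4 = c1 * Real.cos θ +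
        (c3 + c4) * (Real.sin θ ^ 2 + Real.cos θ ^ 2) := by
      rw [Real.sin_sq_add_cos_sq]
      ring
    rw [key] at hpos
    have h : 0 < (c1 * Real.cos θ + (c3 + c4) * (Real.sin θ ^ 2 + Real.cos θ ^ 2)) /
        trigForm c0 c1 c3 c4 (θ, θ) ^ 2 := by positivity
    refine lt_of_eq_of_lt ?_ (neg_neg_of_pos h)
    field_simp
    ring
end
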